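/- (Calderón–Zygmund decomposition on T^ω.) Let f ∈ L¹(T^ω) and a > ‖f‖₁. Then there exist a closed set F_a and its open complement Ω_a = T^ω \ F_a such that: (i) |f(x)| ≤ a for almost every x ∈ F_a; (ii) Ω_a is the union of a sequence {I_j} of pairwise disjoint intervals of the family ℛ₀ = {t + V_m : m ∈ ℕ, t ∈ H_m} satisfying a ≤ (1/m(I_j)) ∫_{I_j} |f| ≤ 2a for every j; (iii) m(Ω_a) ≤ ‖f‖₁ / a. -/

import Mathlib

open MeasureTheory Filter Topology Pointwise

/-- The infinite torus `T^ω`, the countable product of circles `T = ℝ/ℤ`. -/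
abbrev Tomega : Type := ℕ → AddCircle (1 : ℝ)

/-- The open arc of the circle `T = ℝ/ℤ` which is the image of the interval `(a, b) ⊂ ℝ`. -/
def arc (a b : ℝ) : Set (AddCircle (1 : ℝ)) :=
  (fun t : ℝ => (t : AddCircle (1 : ℝ))) '' Set.Ioo a b

/-- The subgroup `R_k = {0, 1/k, …, (k-1)/k}` of `k`-th roots of unity in `T = ℝ/ℤ`. -/
noncomputable def Rsub (k : ℕ) : AddSubgroup (AddCircle (1 : ℝ)) :=
  AddSubgroup.zmultiples (((k : ℝ)⁻¹ : ℝ) : AddCircle (1 : ℝ))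

/-- The exponent pattern of the Rubio de Francia construction: for `m = n² + j` with
`1 ≤ j ≤ 2n+1` (so `n = Nat.sqrt (m-1)`), the `i`-th coordinate (0-indexed) of `H_m` is
`R_{2^(rdfExp m i)}` and the `i`-th edge of `V_m` is `(0, 2^{-(rdfExp m i)})`; coordinates
with exponent `0` carry the trivial subgroup `{0}`, resp. the full circle `T`. -/
def rdfExp (m i : ℕ) : ℕ :=
  let n := Nat.sqrt (m - 1)
  let j := m - n ^ 2
  if j ≤ n then (if i < n then n else if i = n then j else 0)
  else (if i < j - n then n + 1 else if i ≤ n then n else 0)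

/-- The finite subgroup `H_m` of `T^ω` of the Rubio de Francia construction. -/
noncomputable def Hgrp (m : ℕ) : AddSubgroup Tomega :=
  AddSubgroup.pi Set.univ fun i => Rsub (2 ^ rdfExp m i)

/-- The fundamental domain `V_m` for `T^ω / H_m` of the Rubio de Francia construction. -/
def Vset (m : ℕ) : Set Tomega :=
  {x | ∀ i, rdfExp m i ≠ 0 → x i ∈ arc 0 ((2 : ℝ) ^ rdfExp m i)⁻¹}

theorem rdfExp_eq (n j i : ℕ) (h1 : 1 ≤ j) (h2 : j ≤ 2 * n + 1) : rdfExp (n ^ 2 + j) i =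
    if j ≤ n then (if i < n then n else if i = n then j else 0)
    else (if i < j - n then n + 1 else if i ≤ n then n else 0) := by
  have hs : Nat.sqrt (n ^ 2 + j - 1) = n := by
    rw [Nat.add_sub_assoc h1, pow_two]
    exact Nat.sqrt_add_eq n (by omega)
  simp only [rdfExp, hs, Nat.add_sub_cancel_left]

theorem rdfExp_succ (m : ℕ) : ∃ i₀, rdfExp (m + 1) i₀ = rdfExp m i₀ + 1 ∧
    ∀ i, i ≠ i₀ → rdfExp (m + 1) i = rdfExp m i := by
  obtain rfl | hm := Nat.eq_zero_or_pos m
  · exact ⟨0, by decide, fun i hi => by simp [rdfExp]; omega⟩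
  obtain ⟨n, j, hj1, hj2, rfl⟩ : ∃ n j, 1 ≤ j ∧ j ≤ 2 * n + 1 ∧ m = n ^ 2 + j := by
    have h1 := Nat.sqrt_le' (m - 1)
    have h2 := Nat.lt_succ_sqrt' (m - 1)
    refine ⟨Nat.sqrt (m - 1), m - Nat.sqrt (m - 1) ^ 2, by omega, ?_, by omega⟩
    simp only [Nat.succ_eq_add_one, add_sq] at h2
    omega
  obtain hj | rfl := hj2.lt_or_eq
  · simp only [add_assoc, rdfExp_eq n _ _ hj1 hj2, rdfExp_eq n (j + 1) _ (by omega) hj]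
    obtain h | h := lt_or_ge j n
    · exact ⟨n, by grind, by grind⟩
    · exact ⟨j - n, by grind, by grind⟩
  · refine ⟨n + 1, ?_⟩
    have h : n ^ 2 + (2 * n + 1) + 1 = (n + 1) ^ 2 + 1 := by ring
    simp only [h, rdfExp_eq n _ _ hj1 hj2, rdfExp_eq (n + 1) 1 _ le_rfl (by omega)]
    grind

theorem rdfExp_mono (i : ℕ) : Monotone fun m => rdfExp m i := by
  refine monotone_nat_of_le_succ fun m => ?_
  obtain ⟨i₀, h0, h1⟩ := rdfExp_succ m
  by_cases h : i = i₀
  · subst h; omega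
  · exact (h1 i h).ge

theorem tendsto_rdfExp (i : ℕ) : Tendsto (fun m => rdfExp m i) atTop atTop := by
  refine tendsto_atTop_atTop_of_monotone (rdfExp_mono i) fun b => ?_
  refine ⟨(b + i + 1) ^ 2 + 1, ?_⟩
  rw [rdfExp_eq _ _ _ le_rfl (by omega)]
  grind

/-- The representative in `[0, 1)` of a point of the circle `ℝ/ℤ`. -/
noncomputable def circleRep (y : AddCircle (1 : ℝ)) : ℝ := (AddCircle.equivIco 1 0 y : ℝ)

theorem circleRep_nonneg (y : AddCircle (1 : ℝ)) : 0 ≤ circleRep y :=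
  (AddCircle.equivIco 1 0 y).2.1

theorem circleRep_lt_one (y : AddCircle (1 : ℝ)) : circleRep y < 1 :=
  (AddCircle.equivIco 1 0 y).2.2.trans_eq (zero_add 1)

theorem coe_circleRep (y : AddCircle (1 : ℝ)) : (circleRep y : AddCircle (1 : ℝ)) = y :=
  AddCircle.coe_equivIco

theorem circleRep_coe (r : ℝ) : circleRep (r : AddCircle (1 : ℝ)) = Int.fract r := by
  refine (AddCircle.coe_equivIco_mk_apply (1 : ℝ) r).trans ?_
  rw [div_one, mul_one]

theorem measurable_circleRep : Measurable circleRep :=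
  measurable_subtype_coe.comp (AddCircle.measurableEquivIco 1 0).measurable

theorem sub_zsmul_mem_arc_iff (e : ℕ) (n : ℤ) (y : AddCircle (1 : ℝ)) :
    y - n • ((((2 : ℝ) ^ e)⁻¹ : ℝ) : AddCircle (1 : ℝ)) ∈ arc 0 ((2 : ℝ) ^ e)⁻¹ ↔
      ((n % 2 ^ e : ℤ) : ℝ) < 2 ^ e * circleRep y ∧
        2 ^ e * circleRep y < ((n % 2 ^ e : ℤ) : ℝ) + 1 := by
  have hp : (0 : ℝ) < 2 ^ e := by positivity
  have hn : (n : ℝ) = (n % 2 ^ e : ℤ) + 2 ^ e * (n / 2 ^ e : ℤ) := by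
    exact_mod_cast (Int.emod_add_mul_ediv n (2 ^ e)).symm
  have h0 : (0 : ℝ) ≤ (n % 2 ^ e : ℤ) := by
    exact_mod_cast Int.emod_nonneg n (by positivity)
  have h1 : ((n % 2 ^ e : ℤ) : ℝ) + 1 ≤ 2 ^ e := by
    exact_mod_cast Int.add_one_le_of_lt (Int.emod_lt_of_pos n (by positivity))
  generalize (n % 2 ^ e : ℤ) = k at *
  have key : ∀ u : ℝ, (u : AddCircle (1 : ℝ)) + n • ((((2 : ℝ) ^ e)⁻¹ : ℝ) : AddCircle (1 : ℝ)) =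
      ((k / 2 ^ e + u : ℝ) : AddCircle (1 : ℝ)) := by
    intro u
    have : (u : ℝ) + n • (((2 : ℝ) ^ e)⁻¹) = (k / 2 ^ e + u) + ((n / 2 ^ e : ℤ) : ℝ) * 1 := by
      rw [zsmul_eq_mul, hn]
      field_simp
      ring
    rw [← AddCircle.coe_zsmul, ← AddCircle.coe_add, this, AddCircle.coe_add, mul_one]
    simp
  constructor
  · rintro ⟨u, ⟨hu0, hu1⟩, hu⟩
    have hy : y = ((k / 2 ^ e + u : ℝ) : AddCircle (1 : ℝ)) := by
      rw [← key]
      exact (sub_eq_iff_eq_add.1 hu.symm)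
    have hu2 : 2 ^ e * u < 1 := by
      rwa [← lt_inv_mul_iff₀ hp, mul_one]
    have hu3 : 0 < 2 ^ e * u := by positivity
    have hs : 2 ^ e * (k / 2 ^ e + u) = k + 2 ^ e * u := by field_simp
    have hf : Int.fract (k / 2 ^ e + u : ℝ) = k / 2 ^ e + u := by
      refine Int.fract_eq_self.2 ⟨by positivity, ?_⟩
      refine lt_of_mul_lt_mul_left ?_ hp.le
      rw [hs]
      linarith
    rw [hy, circleRep_coe, hf, hs]
    constructor <;> linarith
  · rintro ⟨h2, h3⟩
    refine ⟨circleRep y - k / 2 ^ e, ⟨?_, ?_⟩, ?_⟩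
    · rw [sub_pos, div_lt_iff₀ hp]
      linarith
    · rw [sub_lt_iff_lt_add, ← one_div, ← add_div, lt_div_iff₀ hp]
      linarith
    · rw [eq_sub_iff_add_eq]
      refine (key _).trans ?_
      rw [add_sub_cancel, coe_circleRep]

/-- Translates of `V_m` by `H_m` are dyadic boxes. -/
theorem exists_mem_vadd_Vset_iff {m : ℕ} {t : Tomega} (ht : t ∈ Hgrp m) :
    ∃ k : ℕ → ℤ, ∀ y, y ∈ t +ᵥ Vset m ↔ ∀ i, rdfExp m i ≠ 0 →
      (k i : ℝ) < 2 ^ rdfExp m i * circleRep (y i) ∧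
        2 ^ rdfExp m i * circleRep (y i) < k i + 1 := by
  have h : ∀ i, ∃ n : ℤ, n • ((((2 : ℝ) ^ rdfExp m i)⁻¹ : ℝ) : AddCircle (1 : ℝ)) = t i := by
    intro i
    have := ht i (Set.mem_univ i)
    simpa [Rsub, AddSubgroup.mem_zmultiples_iff] using this
  choose n hn using h
  refine ⟨fun i => n i % 2 ^ rdfExp m i, fun y => ?_⟩
  rw [Set.mem_vadd_set_iff_neg_vadd_mem]
  simp only [Vset, Set.mem_ofPred_eq, ← sub_zsmul_mem_arc_iff, hn]
  refine forall₂_congr fun i _ => ?_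
  simp [neg_add_eq_sub]

/-- The points of `T^ω` without dyadic coordinates. -/
def nondyadic : Set Tomega := {x | ∀ (i e : ℕ) (k : ℤ), (k : ℝ) ≠ 2 ^ e * circleRep (x i)}

theorem floor_lt_of_mem_nondyadic {x : Tomega} (hx : x ∈ nondyadic) (i e : ℕ) :
    (⌊2 ^ e * circleRep (x i)⌋ : ℝ) < 2 ^ e * circleRep (x i) :=
  (Int.floor_le _).lt_of_ne (hx i e _)

theorem exists_mem_vadd_Vset {x : Tomega} (hx : x ∈ nondyadic) (m : ℕ) :
    ∃ t ∈ Hgrp m, x ∈ t +ᵥ Vset m := by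
  refine ⟨fun i => ⌊2 ^ rdfExp m i * circleRep (x i)⌋ •
    ((((2 : ℝ) ^ rdfExp m i)⁻¹ : ℝ) : AddCircle (1 : ℝ)), fun i _ => ?_, ?_⟩
  · simp [Rsub, AddSubgroup.mem_zmultiples_iff]
  · rw [Set.mem_vadd_set_iff_neg_vadd_mem]
    intro i _
    have hp : (0 : ℝ) < 2 ^ rdfExp m i := by positivity
    have h := circleRep_nonneg (x i)
    have := sub_zsmul_mem_arc_iff (rdfExp m i) ⌊2 ^ rdfExp m i * circleRep (x i)⌋ (x i)
    rw [Int.emod_eq_of_lt (Int.floor_nonneg.2 (by positivity))] at this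
    · simp only [vadd_eq_add, Pi.add_apply, Pi.neg_apply, neg_add_eq_sub]
      exact this.2 ⟨floor_lt_of_mem_nondyadic hx i _, Int.lt_floor_add_one _⟩
    · rw [Int.floor_lt]
      push_cast
      nlinarith [circleRep_lt_one (x i)]

theorem vadd_Vset_subset {m m' : ℕ} (hm : m ≤ m') {t s x : Tomega} (ht : t ∈ Hgrp m)
    (hs : s ∈ Hgrp m') (hxt : x ∈ t +ᵥ Vset m) (hxs : x ∈ s +ᵥ Vset m') :
    s +ᵥ Vset m' ⊆ t +ᵥ Vset m := by
  obtain ⟨k, hk⟩ := exists_mem_vadd_Vset_iff ht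
  obtain ⟨l, hl⟩ := exists_mem_vadd_Vset_iff hs
  intro y hy
  rw [hk] at hxt ⊢
  rw [hl] at hxs hy
  intro i hi
  obtain ⟨d, hd⟩ := Nat.exists_eq_add_of_le (rdfExp_mono i hm)
  simp only at hd
  obtain ⟨a1, a2⟩ := hxt i hi
  obtain ⟨b1, b2⟩ := hxs i (by omega)
  obtain ⟨c1, c2⟩ := hy i (by omega)
  rw [hd, pow_add] at b1 b2 c1 c2
  have hp : (0 : ℝ) < 2 ^ d := by positivity
  have e1 : k i * 2 ^ d < l i + 1 := by
    have : (k i : ℝ) * 2 ^ d < l i + 1 := by nlinarith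
    exact_mod_cast this
  have e2 : l i < (k i + 1) * 2 ^ d := by
    have : (l i : ℝ) < (k i + 1) * 2 ^ d := by nlinarith
    exact_mod_cast this
  have e3 : (k i : ℝ) * 2 ^ d ≤ l i := by exact_mod_cast Int.lt_add_one_iff.1 e1
  have e4 : (l i : ℝ) + 1 ≤ (k i + 1) * 2 ^ d := by exact_mod_cast Int.add_one_le_of_lt e2
  constructor <;> refine lt_of_mul_lt_mul_right ?_ hp.le <;> linarith

theorem isOpen_arc (a b : ℝ) : IsOpen (arc a b) :=
  QuotientAddGroup.isOpenMap_coe _ isOpen_Ioo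

theorem finite_rdfExp_ne_zero (m : ℕ) : {i | rdfExp m i ≠ 0}.Finite := by
  refine (Set.finite_Iic (Nat.sqrt (m - 1) + m)).subset fun i hi => ?_
  contrapose! hi
  simp only [Set.mem_Iic, not_le] at hi
  simp only [rdfExp, Set.mem_ofPred_eq, not_not]
  grind

theorem isOpen_Vset (m : ℕ) : IsOpen (Vset m) :=
  isOpen_set_pi (finite_rdfExp_ne_zero m) fun _ _ => isOpen_arc _ _

theorem isOpen_vadd_Vset (m : ℕ) (t : Tomega) : IsOpen (t +ᵥ Vset m) :=
  (isOpen_Vset m).vadd t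

theorem Vset_zero : Vset 0 = Set.univ := by
  simp [Vset, rdfExp]

section Measure

variable {μ : Measure Tomega} [μ.IsAddHaarMeasure] [IsProbabilityMeasure μ]

theorem ae_mem_nondyadic : ∀ᵐ x ∂μ, x ∈ nondyadic := by
  simp only [nondyadic, Set.mem_ofPred_eq, ae_all_iff]
  intro i e k
  have := Measure.isAddHaarMeasure_map_of_isFiniteMeasure μ
    (Pi.evalAddMonoidHom (fun _ : ℕ => AddCircle (1 : ℝ)) i) (continuous_apply i)
    (Function.surjective_eval i)
  have h : ∀ᵐ y ∂(μ.map (Pi.evalAddMonoidHom (fun _ : ℕ => AddCircle (1 : ℝ)) i)),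
      y ≠ ((k / 2 ^ e : ℝ) : AddCircle (1 : ℝ)) := by
    have : Nontrivial (Set.Ico (0 : ℝ) (0 + 1)) :=
      ⟨⟨0, by norm_num⟩, ⟨1 / 2, by norm_num⟩, by norm_num⟩
    have : Nontrivial (AddCircle (1 : ℝ)) := (AddCircle.equivIco (1 : ℝ) 0).nontrivial
    have := Measure.IsAddHaarMeasure.nullSingletonClass
      (μ.map (Pi.evalAddMonoidHom (fun _ : ℕ => AddCircle (1 : ℝ)) i))
    exact compl_mem_ae_iff.2 (measure_singleton _)
  filter_upwards [ae_of_ae_map (measurable_pi_apply i).aemeasurable h] with x hx hk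
  refine hx ?_
  rw [hk, mul_div_cancel_left₀ _ (by positivity), coe_circleRep]

theorem measure_Vset_ne_zero (m : ℕ) : μ (Vset m) ≠ 0 := by
  obtain ⟨x, hx⟩ := (ae_mem_nondyadic (μ := μ)).exists
  obtain ⟨t, -, hxt⟩ := exists_mem_vadd_Vset hx m
  exact (isOpen_Vset m).measure_ne_zero μ (Set.vadd_set_nonempty.1 ⟨x, hxt⟩)

theorem measure_Vset_le (m : ℕ) : μ (Vset m) ≤ 2 * μ (Vset (m + 1)) := by
  obtain ⟨i₀, h0, h1⟩ := rdfExp_succ m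
  set s : Tomega := Pi.single i₀ ((((2 : ℝ) ^ rdfExp (m + 1) i₀)⁻¹ : ℝ) : AddCircle (1 : ℝ))
  have hsub : Vset m ∩ nondyadic ⊆ Vset (m + 1) ∪ (s +ᵥ Vset (m + 1)) := by
    rintro x ⟨hx, hxd⟩
    have key (n : ℤ) := sub_zsmul_mem_arc_iff (rdfExp (m + 1) i₀) n (x i₀)
    have hlt : 2 ^ rdfExp m i₀ * circleRep (x i₀) < 1 := by
      by_cases hi : rdfExp m i₀ = 0
      · simpa [hi] using circleRep_lt_one (x i₀)
      · have := sub_zsmul_mem_arc_iff (rdfExp m i₀) 0 (x i₀)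
        simp only [zero_smul, sub_zero, Int.zero_emod, Int.cast_zero, zero_add] at this
        exact (this.1 (hx i₀ hi)).2
    have hgt : 0 < circleRep (x i₀) :=
      (circleRep_nonneg _).lt_of_ne (by simpa using hxd i₀ 0 0)
    have h2 : (2 : ℝ) ^ rdfExp (m + 1) i₀ = 2 ^ rdfExp m i₀ * 2 := by rw [h0, pow_succ]
    have hother : ∀ i, i ≠ i₀ → rdfExp (m + 1) i ≠ 0 →
        x i ∈ arc 0 ((2 : ℝ) ^ rdfExp (m + 1) i)⁻¹ := by
      intro i hi h
      rw [h1 i hi] at h ⊢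
      exact hx i h
    obtain h | h := (hxd i₀ (rdfExp (m + 1) i₀) 1).lt_or_gt
    · right
      rw [Set.mem_vadd_set_iff_neg_vadd_mem]
      intro i hi
      simp only [vadd_eq_add, Pi.add_apply, Pi.neg_apply, neg_add_eq_sub]
      obtain rfl | hne := eq_or_ne i i₀
      · have := key 1
        rw [one_smul, Int.emod_eq_of_lt (by norm_num)
          (by exact_mod_cast Nat.one_lt_two_pow hi)] at this
        simp only [s, Pi.single_eq_same]
        refine this.2 ⟨h, ?_⟩
        rw [h2]
        push_cast
        linarith
      · simpa [s, hne] using hother i hne hi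
    · left
      intro i hi
      obtain rfl | hne := eq_or_ne i i₀
      · have := key 0
        simp only [zero_smul, sub_zero, Int.zero_emod, Int.cast_zero, zero_add] at this
        exact this.2 ⟨by positivity, by simpa using h⟩
      · exact hother i hne hi
  calc μ (Vset m) = μ (Vset m ∩ nondyadic) :=
        (measure_inter_conull ae_mem_nondyadic).symm
    _ ≤ μ (Vset (m + 1)) + μ (s +ᵥ Vset (m + 1)) :=
        (measure_mono hsub).trans (measure_union_le _ _)
    _ = 2 * μ (Vset (m + 1)) := by rw [measure_vadd, two_mul]

end Measure

/-- The dyadic code of level `m` of a point of `T^ω`. -/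
noncomputable def dyadicCode (m : ℕ) (x : Tomega) : ℕ → ℤ :=
  fun i => ⌊2 ^ rdfExp m i * circleRep (x i)⌋

theorem measurable_dyadicCode (m : ℕ) : Measurable (dyadicCode m) :=
  measurable_pi_lambda _ fun i =>
    ((measurable_circleRep.comp (measurable_pi_apply i)).const_mul _).floor

theorem dyadicCode_eq_of_le {m m' : ℕ} (h : m ≤ m') (x : Tomega) (i : ℕ) :
    dyadicCode m x i = dyadicCode m' x i / 2 ^ (rdfExp m' i - rdfExp m i) := by
  obtain ⟨d, hd⟩ := Nat.exists_eq_add_of_le (rdfExp_mono i h)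
  simp only at hd
  have : (2 : ℝ) ^ rdfExp m i * circleRep (x i) =
      (2 ^ rdfExp m' i * circleRep (x i)) / (2 ^ d : ℕ) := by
    rw [hd, pow_add]
    push_cast
    field_simp
  rw [dyadicCode, dyadicCode, this, Int.floor_div_natCast, hd, Nat.add_sub_cancel_left]
  push_cast
  rfl

/-- The filtration of `T^ω` by half-open dyadic boxes. -/
noncomputable def dyadicFiltration :
    Filtration ℕ (inferInstance : MeasurableSpace Tomega) where
  seq m := MeasurableSpace.comap (dyadicCode m) inferInstance
  mono' m m' h := by
    have : dyadicCode m = (fun (k : ℕ → ℤ) i => k i / 2 ^ (rdfExp m' i - rdfExp m i)) ∘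
        dyadicCode m' := by
      ext x i
      exact dyadicCode_eq_of_le h x i
    simp only [this, ← MeasurableSpace.comap_comp]
    refine MeasurableSpace.comap_mono (Measurable.comap_le ?_)
    fun_prop
  le' m := (measurable_dyadicCode m).comap_le

theorem tendsto_floor_two_pow_mul_div {e : ℕ → ℕ} (he : Tendsto e atTop atTop) (r : ℝ) :
    Tendsto (fun m => (⌊2 ^ e m * r⌋ : ℝ) / 2 ^ e m) atTop (𝓝 r) := by
  have h : Tendsto (fun m => r - (2⁻¹ : ℝ) ^ e m) atTop (𝓝 r) := by
    simpa using ((tendsto_pow_atTop_nhds_zero_of_lt_one (by norm_num)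
      (by norm_num : (2⁻¹ : ℝ) < 1)).comp he).const_sub r
  refine tendsto_of_tendsto_of_tendsto_of_le_of_le h tendsto_const_nhds (fun m => ?_) fun m => ?_
  · have hp : (0 : ℝ) < 2 ^ e m := by positivity
    simp only [inv_pow]
    rw [le_div_iff₀ hp, sub_mul, inv_mul_cancel₀ hp.ne']
    linarith [Int.lt_floor_add_one (2 ^ e m * r)]
  · have hp : (0 : ℝ) < 2 ^ e m := by positivity
    simp only
    rw [div_le_iff₀ hp]
    linarith [Int.floor_le (2 ^ e m * r)]

theorem iSup_dyadicFiltration :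
    ⨆ m, dyadicFiltration m = (inferInstance : MeasurableSpace Tomega) := by
  refine le_antisymm (iSup_le dyadicFiltration.le) ?_
  refine iSup_le fun i => Measurable.comap_le ?_
  have hcode {σ : MeasurableSpace Tomega} (m : ℕ) (h : Measurable[σ] (dyadicCode m)) :
      Measurable[σ] fun x => (dyadicCode m x i : ℝ) / 2 ^ rdfExp m i := by
    fun_prop
  have h : Measurable[⨆ m, dyadicFiltration m] fun x : Tomega => circleRep (x i) := by
    refine @measurable_of_tendsto_metrizable _ _ (⨆ m, dyadicFiltration m) _ _ _ _
      (fun m x => (dyadicCode m x i : ℝ) / 2 ^ rdfExp m i) _ (fun m => ?_) ?_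
    · exact hcode m ((comap_measurable _).mono (le_iSup dyadicFiltration m) le_rfl)
    · rw [tendsto_pi_nhds]
      exact fun x => tendsto_floor_two_pow_mul_div (tendsto_rdfExp i) _
  simpa only [Function.comp_def, coe_circleRep] using (AddCircle.measurable_mk' (a := 1)).comp h

theorem mem_vadd_Vset_iff_dyadicCode_eq {m : ℕ} {t x y : Tomega} (ht : t ∈ Hgrp m)
    (hx : x ∈ t +ᵥ Vset m) (hy : y ∈ nondyadic) :
    y ∈ t +ᵥ Vset m ↔ dyadicCode m y = dyadicCode m x := by
  obtain ⟨k, hk⟩ := exists_mem_vadd_Vset_iff ht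
  rw [hk] at hx ⊢
  have hxk : ∀ i, rdfExp m i ≠ 0 → dyadicCode m x i = k i := fun i hi =>
    Int.floor_eq_iff.2 ⟨(hx i hi).1.le, (hx i hi).2⟩
  constructor
  · intro h
    ext i
    by_cases hi : rdfExp m i = 0
    · have hz : ∀ z : Tomega, dyadicCode m z i = 0 := fun z => by
        simp [dyadicCode, hi, Int.floor_eq_zero_iff, circleRep_nonneg, circleRep_lt_one]
      rw [hz, hz]
    · rw [hxk i hi]
      exact Int.floor_eq_iff.2 ⟨(h i hi).1.le, (h i hi).2⟩
  · intro h i hi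
    have hyk : ⌊2 ^ rdfExp m i * circleRep (y i)⌋ = k i := (congrFun h i).trans (hxk i hi)
    rw [← hyk]
    exact ⟨floor_lt_of_mem_nondyadic hy i _, Int.lt_floor_add_one _⟩

section Differentiation

variable {μ : Measure Tomega} [μ.IsAddHaarMeasure] [IsProbabilityMeasure μ] {g : Tomega → ℝ}

theorem condExp_dyadicFiltration_mul (hg : Integrable g μ) {m : ℕ} {t x : Tomega}
    (ht : t ∈ Hgrp m) (hx : x ∈ t +ᵥ Vset m) :
    (μ[g | dyadicFiltration m]) x * μ.real (t +ᵥ Vset m) = ∫ y in t +ᵥ Vset m, g y ∂μ := by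
  set C : Set Tomega := dyadicCode m ⁻¹' {dyadicCode m x}
  have hC : MeasurableSet[dyadicFiltration m] C := ⟨_, measurableSet_singleton _, rfl⟩
  have hAC : (t +ᵥ Vset m : Set Tomega) =ᵐ[μ] C := by
    filter_upwards [ae_mem_nondyadic (μ := μ)] with y hy
    exact propext (mem_vadd_Vset_iff_dyadicCode_eq ht hx hy)
  have hconst : ∀ y ∈ C, (μ[g | dyadicFiltration m]) y = (μ[g | dyadicFiltration m]) x := by
    obtain ⟨T, -, hT⟩ := (stronglyMeasurable_condExp (μ := μ) (f := g)
      (m := dyadicFiltration m)).measurable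
      (measurableSet_singleton ((μ[g | dyadicFiltration m]) x))
    intro y hy
    have hxT : dyadicCode m x ∈ T := by
      change x ∈ dyadicCode m ⁻¹' T
      rw [hT]
      rfl
    have hyT : y ∈ dyadicCode m ⁻¹' T := by
      rwa [Set.mem_preimage, show dyadicCode m y = dyadicCode m x from hy]
    rw [hT] at hyT
    exact hyT
  rw [setIntegral_congr_set hAC, measureReal_congr hAC,
    ← setIntegral_condExp (dyadicFiltration.le m) hg hC,
    setIntegral_congr_fun (dyadicFiltration.le m _ hC) hconst, setIntegral_const,
    smul_eq_mul, mul_comm]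

theorem measureReal_vadd_Vset_pos (m : ℕ) (t : Tomega) : 0 < μ.real (t +ᵥ Vset m) := by
  rw [Measure.real, measure_vadd]
  exact ENNReal.toReal_pos (measure_Vset_ne_zero m) (measure_ne_top _ _)

/-- A differentiation theorem for the dyadic intervals of `T^ω`. -/
theorem ae_le_of_setIntegral_vadd_Vset_le (hg : Integrable g μ) (a : ℝ) :
    ∀ᵐ x ∂μ, (∀ m, ∀ t ∈ Hgrp m, x ∈ t +ᵥ Vset m →
      ∫ y in t +ᵥ Vset m, g y ∂μ ≤ a * μ.real (t +ᵥ Vset m)) → g x ≤ a := by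
  have hlim : μ[g | ⨆ m, dyadicFiltration m] =ᵐ[μ] g := by
    rw [iSup_dyadicFiltration]
    exact condExp_of_aestronglyMeasurable' le_rfl hg.1 hg
  filter_upwards [ae_mem_nondyadic (μ := μ), hlim,
    tendsto_ae_condExp (μ := μ) (ℱ := dyadicFiltration) g] with x hx hxg hxlim h
  rw [hxg] at hxlim
  refine le_of_tendsto' hxlim fun m => ?_
  obtain ⟨t, ht, hxt⟩ := exists_mem_vadd_Vset hx m
  refine le_of_mul_le_mul_right ?_ (measureReal_vadd_Vset_pos (μ := μ) m t)
  rw [condExp_dyadicFiltration_mul hg ht hxt]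
  exact h m t ht hxt

end Differentiation

/-- Every dyadic interval of level `m + 1` lies in one of level `m` and at most twice as large. -/
theorem exists_parent (μ : Measure Tomega) [μ.IsAddHaarMeasure] [IsProbabilityMeasure μ] {m : ℕ}
    {t : Tomega} (ht : t ∈ Hgrp (m + 1)) :
    ∃ s ∈ Hgrp m, t +ᵥ Vset (m + 1) ⊆ s +ᵥ Vset m ∧
      μ.real (s +ᵥ Vset m) ≤ 2 * μ.real (t +ᵥ Vset (m + 1)) := by
  obtain ⟨x, hx, hxd⟩ : ((t +ᵥ Vset (m + 1)) ∩ nondyadic).Nonempty := by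
    refine nonempty_of_measure_ne_zero (μ := μ) ?_
    have h : μ ((t +ᵥ Vset (m + 1)) ∩ nondyadic) = μ (t +ᵥ Vset (m + 1)) :=
      measure_inter_conull ae_mem_nondyadic
    rw [h, measure_vadd]
    exact measure_Vset_ne_zero _
  obtain ⟨s, hs, hxs⟩ := exists_mem_vadd_Vset hxd m
  refine ⟨s, hs, vadd_Vset_subset m.le_succ hs ht hxs hx, ?_⟩
  have := ENNReal.toReal_mono (ENNReal.mul_ne_top (by simp) (measure_ne_top _ _))
    (measure_Vset_le (μ := μ) m)
  simpa [Measure.real, measure_vadd] using this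

/-- The dyadic interval `t + V_m` is a maximal one on which the average of `|f|` exceeds `a`. -/
structure IsStopping (μ : Measure Tomega) (f : Tomega → ℝ) (a : ℝ) (m : ℕ) (t : Tomega) :
    Prop where
  mem : t ∈ Hgrp m
  lt : a * μ.real (t +ᵥ Vset m) < ∫ x in t +ᵥ Vset m, |f x| ∂μ
  maximal : ∀ m' < m, ∀ t' ∈ Hgrp m', t +ᵥ Vset m ⊆ t' +ᵥ Vset m' →
    ∫ x in t' +ᵥ Vset m', |f x| ∂μ ≤ a * μ.real (t' +ᵥ Vset m')

/-- The family of stopping dyadic intervals of `f` at height `a`. -/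
def stoppingIntervals (μ : Measure Tomega) (f : Tomega → ℝ) (a : ℝ) : Set (Set Tomega) :=
  {A | ∃ m t, IsStopping μ f a m t ∧ A = t +ᵥ Vset m}

section Stopping

variable {μ : Measure Tomega} {f : Tomega → ℝ} {a : ℝ}

theorem IsStopping.eq_of_mem {m m' : ℕ} {t t' x : Tomega} (h : IsStopping μ f a m t)
    (h' : IsStopping μ f a m' t') (hx : x ∈ t +ᵥ Vset m) (hx' : x ∈ t' +ᵥ Vset m') :
    t +ᵥ Vset m = t' +ᵥ Vset m' := by
  obtain hlt | rfl | hlt := lt_trichotomy m m'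
  · exact absurd h.lt
      (h'.maximal m hlt t h.mem (vadd_Vset_subset hlt.le h.mem h'.mem hx hx')).not_gt
  · exact (vadd_Vset_subset le_rfl h'.mem h.mem hx' hx).antisymm
      (vadd_Vset_subset le_rfl h.mem h'.mem hx hx')
  · exact absurd h'.lt
      (h.maximal m' hlt t' h'.mem (vadd_Vset_subset hlt.le h'.mem h.mem hx' hx)).not_gt

theorem pairwiseDisjoint_stoppingIntervals (μ : Measure Tomega) (f : Tomega → ℝ) (a : ℝ) :
    (stoppingIntervals μ f a).PairwiseDisjoint id := by
  rintro _ ⟨m, t, h, rfl⟩ _ ⟨m', t', h', rfl⟩ hne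
  refine Set.disjoint_left.2 fun x hx hx' => hne ?_
  exact h.eq_of_mem h' hx hx'

theorem isOpen_of_mem_stoppingIntervals {A : Set Tomega} (hA : A ∈ stoppingIntervals μ f a) :
    IsOpen A := by
  obtain ⟨m, t, -, rfl⟩ := hA
  exact isOpen_vadd_Vset m t

theorem exists_stopping {m : ℕ} {t x : Tomega} (ht : t ∈ Hgrp m) (hx : x ∈ t +ᵥ Vset m)
    (hlt : a * μ.real (t +ᵥ Vset m) < ∫ x in t +ᵥ Vset m, |f x| ∂μ) :
    x ∈ ⋃₀ stoppingIntervals μ f a := by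
  classical
  have hex : ∃ m, ∃ t ∈ Hgrp m, x ∈ t +ᵥ Vset m ∧
    a * μ.real (t +ᵥ Vset m) < ∫ x in t +ᵥ Vset m, |f x| ∂μ := ⟨m, t, ht, hx, hlt⟩
  obtain ⟨s, hs, hxs, hslt⟩ := Nat.find_spec hex
  refine ⟨_, ⟨Nat.find hex, s, ⟨hs, hslt, fun m' hm' t' ht' hsub => ?_⟩, rfl⟩, hxs⟩
  exact not_lt.1 fun h => Nat.find_min hex hm' ⟨t', ht', hsub hxs, h⟩

theorem IsStopping.one_le [IsProbabilityMeasure μ] {m : ℕ} {t : Tomega} (h : IsStopping μ f a m t)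
    (ha : ∫ x, |f x| ∂μ < a) : 1 ≤ m := by
  by_contra! hm
  obtain rfl : m = 0 := by omega
  have := h.lt
  rw [Vset_zero, Set.vadd_set_univ, setIntegral_univ, probReal_univ] at this
  linarith

variable [μ.IsAddHaarMeasure] [IsProbabilityMeasure μ]

theorem IsStopping.setIntegral_le {m : ℕ} {t : Tomega} (h : IsStopping μ f a m t)
    (hf : Integrable f μ) (ha : ∫ x, |f x| ∂μ < a) :
    ∫ x in t +ᵥ Vset m, |f x| ∂μ ≤ 2 * a * μ.real (t +ᵥ Vset m) := by
  obtain ⟨m, rfl⟩ := Nat.exists_eq_add_of_le' (h.one_le ha)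
  obtain ⟨s, hs, hsub, hle⟩ := exists_parent μ h.mem
  have ha0 : 0 ≤ a := (integral_nonneg fun x => abs_nonneg (f x)).trans ha.le
  calc ∫ x in t +ᵥ Vset (m + 1), |f x| ∂μ ≤ ∫ x in s +ᵥ Vset m, |f x| ∂μ :=
        setIntegral_mono_set hf.abs.integrableOn (.of_forall fun x => abs_nonneg (f x))
          hsub.eventuallyLE
    _ ≤ a * μ.real (s +ᵥ Vset m) := h.maximal m m.lt_succ_self s hs hsub
    _ ≤ a * (2 * μ.real (t +ᵥ Vset (m + 1))) := by gcongr
    _ = 2 * a * μ.real (t +ᵥ Vset (m + 1)) := by ring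

theorem countable_stoppingIntervals : (stoppingIntervals μ f a).Countable := by
  refine (pairwiseDisjoint_stoppingIntervals μ f a).countable_of_isOpen
    (fun A hA => isOpen_of_mem_stoppingIntervals hA) ?_
  rintro _ ⟨m, t, -, rfl⟩
  exact nonempty_of_measure_ne_zero (μ := μ) (by
    rw [id, measure_vadd]; exact measure_Vset_ne_zero m)

theorem measure_sUnion_stoppingIntervals_le (hf : Integrable f μ) (ha : 0 < a) :
    μ (⋃₀ stoppingIntervals μ f a) ≤ ENNReal.ofReal ((∫ x, |f x| ∂μ) / a) := by
  have hc : (stoppingIntervals μ f a).Countable := countable_stoppingIntervals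
  have hm : ∀ A ∈ stoppingIntervals μ f a, MeasurableSet A := fun A hA =>
    (isOpen_of_mem_stoppingIntervals hA).measurableSet
  have hd := pairwiseDisjoint_stoppingIntervals μ f a
  have hle : ENNReal.ofReal a * μ (⋃₀ stoppingIntervals μ f a) ≤ ∫⁻ x, ‖f x‖ₑ ∂μ := by
    rw [measure_sUnion hc hd hm, ← ENNReal.tsum_mul_left]
    calc ∑' A : stoppingIntervals μ f a, ENNReal.ofReal a * μ A
        ≤ ∑' A : stoppingIntervals μ f a, ∫⁻ x in A, ‖f x‖ₑ ∂μ := by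
          refine ENNReal.tsum_le_tsum fun ⟨A, hA⟩ => ?_
          obtain ⟨m, t, h, rfl⟩ := hA
          rw [← ofReal_integral_norm_eq_lintegral_enorm hf.integrableOn,
            ← ofReal_measureReal, ← ENNReal.ofReal_mul ha.le]
          exact ENNReal.ofReal_le_ofReal h.lt.le
      _ = ∫⁻ x in ⋃₀ stoppingIntervals μ f a, ‖f x‖ₑ ∂μ := by
          rw [Set.sUnion_eq_biUnion, lintegral_biUnion hc hm hd]
      _ ≤ ∫⁻ x, ‖f x‖ₑ ∂μ := setLIntegral_le_lintegral _ _
  rw [ENNReal.ofReal_div_of_pos ha]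
  refine (ENNReal.le_div_iff_mul_le (by simp [ha]) (by simp)).2 ?_
  rw [mul_comm]
  refine hle.trans_eq ?_
  rw [← ofReal_integral_norm_eq_lintegral_enorm hf]
  rfl

end Stopping

/-- **Calderón–Zygmund decomposition on `T^ω` (Rubio de Francia).** Let `f ∈ L¹(T^ω)` and
`a > ‖f‖₁`. Then there exist a closed set `F_a` and its open complement `Ω_a = T^ω \ F_a`
such that (i) `|f| ≤ a` a.e. on `F_a`; (ii) `Ω_a` is the union of a countable family of
pairwise disjoint intervals `I_j` of `ℛ₀ = {t + V_m : m ∈ ℕ, t ∈ H_m}` with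
`a ≤ (1/m(I_j)) ∫_{I_j} |f| ≤ 2a` for every `j`; and (iii) `m(Ω_a) ≤ ‖f‖₁/a`. -/
theorem calderon_zygmund_decomposition_Tomega (μ : Measure Tomega) [μ.IsAddHaarMeasure]
    [IsProbabilityMeasure μ] (f : Tomega → ℝ) (hf : Integrable f μ) (a : ℝ)
    (ha : ∫ x, |f x| ∂μ < a) :
    ∃ F : Set Tomega, IsClosed F ∧
      (∀ᵐ x ∂μ, x ∈ F → |f x| ≤ a) ∧
      (∃ (J : Set ℕ) (I : ℕ → Set Tomega),
        (∀ j ∈ J, ∃ m : ℕ, 1 ≤ m ∧ ∃ t ∈ Hgrp m, I j = t +ᵥ Vset m) ∧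
        (J.Pairwise fun i j => Disjoint (I i) (I j)) ∧
        Fᶜ = ⋃ j ∈ J, I j ∧
        (∀ j ∈ J, a ≤ (μ (I j)).toReal⁻¹ * ∫ x in I j, |f x| ∂μ ∧
          (μ (I j)).toReal⁻¹ * ∫ x in I j, |f x| ∂μ ≤ 2 * a)) ∧
      μ Fᶜ ≤ ENNReal.ofReal ((∫ x, |f x| ∂μ) / a) := by
  have ha0 : 0 < a := (integral_nonneg fun x => abs_nonneg (f x)).trans_lt ha
  obtain ⟨e, he⟩ := Set.countable_iff_exists_injOn.1
    (countable_stoppingIntervals (μ := μ) (f := f) (a := a))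
  have hinv := he.leftInvOn_invFunOn
  refine ⟨(⋃₀ stoppingIntervals μ f a)ᶜ, ?_, ?_, ⟨e '' stoppingIntervals μ f a,
    Function.invFunOn e (stoppingIntervals μ f a), ?_, ?_, ?_, ?_⟩, ?_⟩
  · exact (isOpen_sUnion fun A hA => isOpen_of_mem_stoppingIntervals hA).isClosed_compl
  · filter_upwards [ae_le_of_setIntegral_vadd_Vset_le hf.abs a] with x hx hxF
    exact hx fun m t ht hxt => not_lt.1 fun hlt => hxF (exists_stopping ht hxt hlt)
  · rintro _ ⟨_, ⟨m, t, h, rfl⟩, rfl⟩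
    exact ⟨m, h.one_le ha, t, h.mem, hinv ⟨m, t, h, rfl⟩⟩
  · rintro _ ⟨A, hA, rfl⟩ _ ⟨B, hB, rfl⟩ hne
    rw [hinv hA, hinv hB]
    exact pairwiseDisjoint_stoppingIntervals μ f a hA hB fun h => hne (h ▸ rfl)
  · rw [compl_compl, Set.biUnion_image, Set.sUnion_eq_biUnion]
    exact Set.iUnion₂_congr fun A hA => (hinv hA).symm
  · rintro _ ⟨_, ⟨m, t, h, rfl⟩, rfl⟩
    have hpos := measureReal_vadd_Vset_pos (μ := μ) m t
    rw [hinv ⟨m, t, h, rfl⟩, ← Measure.real, inv_mul_eq_div, le_div_iff₀ hpos, div_le_iff₀ hpos]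
    exact ⟨h.lt.le, h.setIntegral_le hf ha⟩
  · rw [compl_compl]
    exact measure_sUnion_stoppingIntervals_le hf ha0
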